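/- arXiv:1809.03460 — 2 statements merged into one kernel-verified Lean document; each statement's English description precedes it below -/
import Mathlib

section
/- Let H(7,3) be the group defined by the cyclic presentation ⟨x₀, x₁, …, x₆ | xᵢ x_{i+3} x_{i+1}⁻¹ (0 ≤ i ≤ 6, subscripts mod 7)⟩ and let w = x₀ x₃ x₆ x₂ x₅ x₁ x₄ ∈ H(7,3). Then the quotient of H(7,3) by the normal closure of w is finite of order 128. -/
/-- The cyclic relators `xᵢ x_{i+3} x_{i+1}⁻¹` (indices mod 7) in the free group
on generators indexed by `ZMod 7`. -/
def H73Rels : Set (FreeGroup (ZMod 7)) :=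
  Set.range fun i : ZMod 7 =>
    FreeGroup.of i * FreeGroup.of (i + 3) * (FreeGroup.of (i + 1))⁻¹

/-- The element `w = x₀ x₃ x₆ x₂ x₅ x₁ x₄` of the Gilbert–Howie group `H(7,3)`. -/
def H73w : PresentedGroup H73Rels :=
  PresentedGroup.of 0 * PresentedGroup.of 3 * PresentedGroup.of 6 *
    PresentedGroup.of 2 * PresentedGroup.of 5 * PresentedGroup.of 1 *
    PresentedGroup.of 4

/-- A family satisfying the relators of `H(7,3)` and `w = 1`, reindexed by `y j = x (3 * j)`. -/
structure IsCyclicFamily {G : Type*} [Group G] (y : ZMod 7 → G) : Prop where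
  mul_succ : ∀ j, y j * y (j + 1) = y (j + 5)
  prod_eq_one : y 0 * y 1 * y 2 * y 3 * y 4 * y 5 * y 6 = 1

namespace IsCyclicFamily

variable {G : Type*} [Group G] {y : ZMod 7 → G}

theorem rotate (h : IsCyclicFamily y) : IsCyclicFamily fun j => y (j + 1) where
  mul_succ j := by
    have := h.mul_succ (j + 1)
    rwa [add_right_comm j 1 5] at this
  prod_eq_one := by
    change y 1 * y 2 * y 3 * y 4 * y 5 * y 6 * y 0 = 1
    rw [mul_eq_one_iff_eq_inv', eq_inv_iff_mul_eq_one]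
    simpa only [mul_assoc] using h.prod_eq_one

theorem shift (h : IsCyclicFamily y) (k : ZMod 7) : IsCyclicFamily fun j => y (j + k) := by
  obtain ⟨n, rfl⟩ := ZMod.natCast_zmod_surjective k
  induction n with
  | zero => simpa using h
  | succ n ih => simpa [add_assoc, add_comm (1 : ZMod 7)] using ih.rotate

theorem mul_four (h : IsCyclicFamily y) : y 0 * y 4 = y 2 * y 1 := by
  have h0 : y 2 * y 3 = y 0 := h.mul_succ 2
  have h1 : y 3 * y 4 = y 1 := h.mul_succ 3
  rw [← h0, ← h1, mul_assoc]

theorem six_five_zero_two (h : IsCyclicFamily y) : y 6 * y 5 * (y 0 * y 2) = 1 := by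
  have h5 : y 0 * y 1 = y 5 := h.mul_succ 0
  have h0 : y 2 * y 3 = y 0 := h.mul_succ 2
  have h2 : y 4 * y 5 = y 2 := h.mul_succ 4
  have hw : y 6 * y 0 * y 1 * y 2 * y 3 * y 4 * y 5 = 1 := (h.shift 6).prod_eq_one
  calc y 6 * y 5 * (y 0 * y 2)
      = y 6 * (y 0 * y 1) * (y 2 * y 3 * (y 4 * y 5)) := by rw [h5, h0, h2]
    _ = 1 := by simpa only [mul_assoc] using hw

theorem four_one_zero_two (h : IsCyclicFamily y) : y 4 * y 1 * (y 0 * y 2) = 1 := by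
  have h4 : y 4 * y 1 = y 6 * y 5 := (h.shift 4).mul_four
  rw [h4, h.six_five_zero_two]

theorem one_eq (h : IsCyclicFamily y) : y 1 = y 5 * (y 6 * y 6) * y 0 := by
  have h1 : y 3 * y 4 = y 1 := h.mul_succ 3
  have h3 : y 5 * y 6 = y 3 := h.mul_succ 5
  have h4 : y 6 * y 0 = y 4 := h.mul_succ 6
  rw [← h1, ← h3, ← h4]
  simp only [mul_assoc]

/-- Each square commutes with the preceding generator. -/
theorem commute_sq_pred (h : IsCyclicFamily y) : Commute (y 6 * y 6) (y 5) := by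
  have h6 : y 1 * y 2 = y 6 := h.mul_succ 1
  refine (mul_right_cancel (b := y 0 * y 2) ?_)
  calc y 6 * y 6 * y 5 * (y 0 * y 2)
      = y 6 * (y 6 * y 5 * (y 0 * y 2)) := by simp only [mul_assoc]
    _ = y 1 * y 2 := by rw [h.six_five_zero_two, mul_one, h6]
    _ = y 5 * (y 6 * y 6) * (y 0 * y 2) := by rw [h.one_eq, mul_assoc]

theorem commute_sq_add_four (h : IsCyclicFamily y) : Commute (y 5 * y 5) (y 2) := by
  have h0 : y 2 * y 3 = y 0 := h.mul_succ 2
  have h2 : y 4 * y 5 = y 2 := h.mul_succ 4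
  have h3 : y 5 * y 6 = y 3 := h.mul_succ 5
  have h4 : y 6 * y 0 = y 4 := h.mul_succ 6
  have h5 : y 0 * y 1 = y 5 := h.mul_succ 0
  have h6 : y 3 * y 0 * (y 6 * y 1) = 1 := (h.shift 6).four_one_zero_two
  have key : y 2 * y 5 = y 5 * (y 3 * y 0) := by
    refine mul_right_cancel (b := y 6 * y 1) ?_
    calc y 2 * y 5 * (y 6 * y 1) = y 2 * (y 5 * y 6) * y 1 := by simp only [mul_assoc]
      _ = y 5 := by rw [h3, h0, h5]
      _ = y 5 * (y 3 * y 0) * (y 6 * y 1) := by rw [mul_assoc (y 5), h6, mul_one]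
  calc y 5 * y 5 * y 2 = y 5 * ((y 5 * y 6) * y 0 * y 5) := by
        rw [← h2, ← h4]; simp only [mul_assoc]
    _ = y 5 * (y 3 * y 0) * y 5 := by rw [h3]; simp only [mul_assoc]
    _ = y 2 * (y 5 * y 5) := by rw [← key, mul_assoc]

theorem sq_mul_sq_mul_sq (h : IsCyclicFamily y) : y 6 * y 6 * (y 0 * y 0) * (y 2 * y 2) = 1 := by
  have h2 : y 4 * y 5 = y 2 := h.mul_succ 4
  have key : y 2 * (y 6 * y 6) * y 0 = y 4 * y 1 := by
    rw [h.one_eq, ← h2]; simp only [mul_assoc]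
  rw [mul_eq_one_comm]
  calc y 2 * y 2 * (y 6 * y 6 * (y 0 * y 0))
      = y 2 * (y 2 * (y 6 * y 6) * y 0 * y 0) := by simp only [mul_assoc]
    _ = 1 := by
      rw [key, mul_eq_one_comm]
      simpa only [mul_assoc] using h.four_one_zero_two

theorem mul_comm_succ (h : IsCyclicFamily y) : y 6 * y 0 = y 0 * y 6 * (y 1 * y 1) := by
  have h1 : y 3 * y 4 = y 1 := h.mul_succ 3
  have h4 : y 6 * y 0 = y 4 := h.mul_succ 6
  have h3 : y 3 * y 0 * (y 6 * y 1) = 1 := (h.shift 6).four_one_zero_two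
  have h6 : y 0 * y 6 * y 1 * y 3 = 1 := by
    rw [mul_eq_one_comm]
    simpa only [mul_assoc] using h3
  calc y 6 * y 0 = y 0 * y 6 * y 1 * y 3 * y 4 := by rw [h6, one_mul, h4]
    _ = y 0 * y 6 * y 1 * y 1 := by rw [mul_assoc _ (y 3), h1]
    _ = _ := mul_assoc _ _ _

theorem mul_comm_add_two (h : IsCyclicFamily y) : y 2 * y 0 = y 0 * y 2 * (y 4 * y 4) := by
  have h4 : y 6 * y 0 = y 4 := h.mul_succ 6
  have h6 : y 1 * y 2 = y 6 := h.mul_succ 1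
  have h1 : y 1 * (y 0 * y 2) * y 4 = 1 := by
    rw [mul_eq_one_comm, ← mul_assoc, h.four_one_zero_two]
  refine mul_left_cancel (a := y 1) ?_
  calc y 1 * (y 2 * y 0) = y 1 * (y 0 * y 2) * y 4 * y 4 := by
        rw [← mul_assoc, h6, h4, h1, one_mul]
    _ = _ := by simp only [mul_assoc]

theorem sq_mul_sq (h : IsCyclicFamily y) : y 6 * y 6 * (y 6 * y 6) = 1 := by
  have h1 : y 3 * y 4 = y 1 := h.mul_succ 3
  have h2 : y 4 * y 5 = y 2 := h.mul_succ 4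
  have h4 : y 6 * y 0 = y 4 := h.mul_succ 6
  have h6 : y 1 * y 2 = y 6 := h.mul_succ 1
  have h31 : y 3 * y 1 = y 1 * y 3 * (y 5 * y 5) := (h.shift 1).mul_comm_add_two
  have h54 : Commute (y 5 * y 5) (y 4) := (h.shift 6).commute_sq_pred
  have h561 : y 5 * y 5 * (y 6 * y 6) * (y 1 * y 1) = 1 := (h.shift 6).sq_mul_sq_mul_sq
  have hsq : y 3 * y 1 * y 4 = y 6 * y 6 := by
    refine mul_right_cancel (b := y 5 * y 0) ?_
    calc y 3 * y 1 * y 4 * (y 5 * y 0) = y 3 * (y 1 * (y 4 * y 5) * y 0) := by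
          simp only [mul_assoc]
      _ = y 5 * (y 6 * y 6) * y 0 := by rw [h2, h6, h4, h1, h.one_eq]
      _ = _ := by rw [← h.commute_sq_pred.eq, mul_assoc]
  calc y 6 * y 6 * (y 6 * y 6) = y 1 * (y 3 * (y 5 * y 5 * y 4)) * (y 6 * y 6) := by
        rw [← hsq, h31]; simp only [mul_assoc]
    _ = y 1 * (y 3 * y 4) * (y 5 * y 5 * (y 6 * y 6)) := by rw [h54.eq]; simp only [mul_assoc]
    _ = 1 := by rw [h1, mul_eq_one_comm, h561]

/-- The commutator of `y 0 ^ 2` and `y 1`, once squares are known to be involutions. -/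
def twist (y : ZMod 7 → G) : G := y 0 * y 0 * ((y 1)⁻¹ * (y 0 * y 0) * y 1)

theorem sq_zero_mul_sq_zero (h : IsCyclicFamily y) : y 0 * y 0 * (y 0 * y 0) = 1 :=
  (h.shift 1).sq_mul_sq

theorem sq_one_mul_sq_one (h : IsCyclicFamily y) : y 1 * y 1 * (y 1 * y 1) = 1 :=
  (h.shift 2).sq_mul_sq

theorem sq_two_mul_sq_two (h : IsCyclicFamily y) : y 2 * y 2 * (y 2 * y 2) = 1 :=
  (h.shift 3).sq_mul_sq

theorem sq_one_commute_zero (h : IsCyclicFamily y) : Commute (y 1 * y 1) (y 0) :=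
  (h.shift 2).commute_sq_pred

theorem sq_two_commute_one (h : IsCyclicFamily y) : Commute (y 2 * y 2) (y 1) :=
  (h.shift 3).commute_sq_pred

theorem sq_zero_mul_sq_one (h : IsCyclicFamily y) : y 0 * y 0 * (y 1 * y 1) = y 3 * y 3 := by
  have h3 : y 3 * y 3 * (y 3 * y 3) = 1 := (h.shift 4).sq_mul_sq
  have h013 : y 0 * y 0 * (y 1 * y 1) * (y 3 * y 3) = 1 := (h.shift 1).sq_mul_sq_mul_sq
  exact mul_right_cancel (h013.trans h3.symm)

theorem sq_one_mul_sq_two (h : IsCyclicFamily y) : y 1 * y 1 * (y 2 * y 2) = y 4 * y 4 :=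
  (h.shift 1).sq_zero_mul_sq_one

theorem sq_zero_commute_sq_one (h : IsCyclicFamily y) : Commute (y 0 * y 0) (y 1 * y 1) :=
  (h.sq_one_commute_zero.mul_right h.sq_one_commute_zero).symm

theorem sq_one_commute_sq_two (h : IsCyclicFamily y) : Commute (y 1 * y 1) (y 2 * y 2) :=
  (h.shift 1).sq_zero_commute_sq_one

theorem sq_zero_commute_sq_two (h : IsCyclicFamily y) : Commute (y 0 * y 0) (y 2 * y 2) := by
  have h3 : Commute (y 3 * y 3) (y 2) := (h.shift 4).commute_sq_pred
  have h0 : y 0 * y 0 = y 3 * y 3 * (y 1 * y 1) := by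
    rw [← h.sq_zero_mul_sq_one, mul_assoc, h.sq_one_mul_sq_one, mul_one]
  rw [h0]
  exact (h3.mul_right h3).mul_left h.sq_one_commute_sq_two

theorem sq_zero_mul_one (h : IsCyclicFamily y) :
    y 0 * y 0 * y 1 = y 1 * (y 0 * y 0) * twist y := by
  have h0 := h.sq_zero_mul_sq_zero
  calc y 0 * y 0 * y 1 = y 1 * 1 * ((y 1)⁻¹ * (y 0 * y 0) * y 1) := by group
    _ = _ := by rw [← h0, twist]; simp only [mul_assoc]

theorem sq_zero_mul_two (h : IsCyclicFamily y) :
    y 0 * y 0 * y 2 = y 2 * (y 0 * y 0) * twist y := by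
  have h04 : Commute (y 0 * y 0) (y 4) := (h.shift 2).commute_sq_add_four
  have h21 : Commute (y 0 * y 0) (y 2 * y 1) := by
    rw [← h.mul_four]
    exact ((Commute.refl (y 0)).mul_left (Commute.refl (y 0))).mul_right h04
  have key : y 2 * ((y 1)⁻¹ * (y 0 * y 0) * y 1) = y 0 * y 0 * y 2 := by
    calc y 2 * ((y 1)⁻¹ * (y 0 * y 0) * y 1)
        = y 2 * ((y 1)⁻¹ * ((y 0 * y 0) * (y 1 * y 1)) * (y 1)⁻¹) := by group
      _ = y 2 * y 1 * (y 0 * y 0) * (y 1)⁻¹ := by rw [h.sq_zero_commute_sq_one.eq]; group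
      _ = y 0 * y 0 * y 2 := by rw [← h21.eq]; group
  rw [twist, ← mul_assoc, mul_assoc (y 2), h.sq_zero_mul_sq_zero, mul_one, key]

theorem sq_zero_commute_twist (h : IsCyclicFamily y) : Commute (y 0 * y 0) (twist y) := by
  have h01 : y 0 * y 1 = y 1 * y 0 * (y 2 * y 2) := (h.shift 1).mul_comm_succ
  have key : (y 1)⁻¹ * (y 0 * y 0) * y 1 = y 0 * (y 2 * y 2) * (y 0 * (y 2 * y 2)) := by
    calc (y 1)⁻¹ * (y 0 * y 0) * y 1 = (y 1)⁻¹ * (y 0 * y 1) * ((y 1)⁻¹ * (y 0 * y 1)) := by group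
      _ = _ := by rw [h01]; group
  have h0 : Commute (y 0 * y 0) (y 0 * (y 2 * y 2)) :=
    ((Commute.refl (y 0)).mul_left (Commute.refl (y 0))).mul_right h.sq_zero_commute_sq_two
  rw [twist, key]
  exact (Commute.refl _).mul_right (h0.mul_right h0)

theorem sq_one_commute_twist (h : IsCyclicFamily y) : Commute (y 1 * y 1) (twist y) := by
  have h0 := h.sq_zero_commute_sq_one.symm
  have h1 : Commute (y 1 * y 1) (y 1) := (Commute.refl (y 1)).mul_left (Commute.refl (y 1))
  exact h0.mul_right ((h1.inv_right.mul_right h0).mul_right h1)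

theorem sq_two_commute_twist (h : IsCyclicFamily y) : Commute (y 2 * y 2) (twist y) := by
  have h0 := h.sq_zero_commute_sq_two.symm
  have h1 := h.sq_two_commute_one
  exact h0.mul_right ((h1.inv_right.mul_right h0).mul_right h1)

theorem twist_mul_twist (h : IsCyclicFamily y) : twist y * twist y = 1 := by
  have h0 : y 0 * y 0 * twist y = (y 1)⁻¹ * (y 0 * y 0) * y 1 := by
    rw [twist, ← mul_assoc, h.sq_zero_mul_sq_zero, one_mul]
  calc twist y * twist y = (y 0 * y 0 * (y 0 * y 0)) * (twist y * twist y) := by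
        rw [h.sq_zero_mul_sq_zero, one_mul]
    _ = (y 0 * y 0 * twist y) * (y 0 * y 0 * twist y) :=
        h.sq_zero_commute_twist.mul_mul_mul_comm _ _
    _ = (y 1)⁻¹ * ((y 0 * y 0) * (y 0 * y 0)) * y 1 := by rw [h0]; group
    _ = 1 := by rw [h.sq_zero_mul_sq_zero]; group

theorem twist_commute_two (h : IsCyclicFamily y) : Commute (twist y) (y 2) := by
  have h12 : y 1 * y 2 = y 6 := h.mul_succ 1
  have h06 : Commute (y 0 * y 0) (y 6) := (h.shift 1).commute_sq_pred
  calc twist y * y 2 = y 0 * y 0 * ((y 1)⁻¹ * ((y 0 * y 0) * (y 1 * y 2))) := by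
        rw [twist]; simp only [mul_assoc]
    _ = y 0 * y 0 * y 2 * (y 0 * y 0) := by rw [h12, h06.eq, ← h12]; group
    _ = y 2 * (y 0 * y 0 * (y 0 * y 0)) * twist y := by
        rw [h.sq_zero_mul_two, mul_assoc _ (twist y), ← h.sq_zero_commute_twist.eq]
        simp only [mul_assoc]
    _ = y 2 * twist y := by rw [h.sq_zero_mul_sq_zero, mul_one]

theorem sq_one_mul_two (h : IsCyclicFamily y) :
    y 1 * y 1 * y 2 = y 2 * (y 1 * y 1) * twist y := by
  have h3 : Commute (y 3 * y 3) (y 2) := (h.shift 4).commute_sq_pred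
  have h1 : y 1 * y 1 = y 3 * y 3 * (y 0 * y 0) := by
    rw [← h.sq_zero_mul_sq_one, h.sq_zero_commute_sq_one.eq, mul_assoc, h.sq_zero_mul_sq_zero,
      mul_one]
  rw [h1, mul_assoc, h.sq_zero_mul_two, ← mul_assoc, ← mul_assoc, h3.eq]
  simp only [mul_assoc]

end IsCyclicFamily

/-- Exponents of the normal form: first on the coset representatives of the abelian normal
subgroup generated by the squares, then on that subgroup. -/
abbrev H73Exponents : Type :=
  (ZMod 2 × ZMod 2 × ZMod 2) × (ZMod 2 × ZMod 2 × ZMod 2 × ZMod 2)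

section NormalForm

variable {G : Type*} [Group G] (y : ZMod 7 → G)

/-- Products of `y 0`, `y 1`, `y 2` with prescribed exponents. -/
def cosetForm (s : ZMod 2 × ZMod 2 × ZMod 2) : G :=
  y 0 ^ s.1.val * y 1 ^ s.2.1.val * y 2 ^ s.2.2.val

/-- Products of the squares of `y 0`, `y 1`, `y 2` and of `twist y` with prescribed exponents. -/
def kernelForm (v : ZMod 2 × ZMod 2 × ZMod 2 × ZMod 2) : G :=
  (y 0 * y 0) ^ v.1.val * (y 1 * y 1) ^ v.2.1.val * (y 2 * y 2) ^ v.2.2.1.val *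
    IsCyclicFamily.twist y ^ v.2.2.2.val

/-- The element with given normal form exponents. -/
def normalForm (t : H73Exponents) : G := cosetForm y t.1 * kernelForm y t.2

@[simp]
theorem normalForm_zero : normalForm y 0 = 1 := by
  simp [normalForm, cosetForm, kernelForm]

theorem map_normalForm {K : Type*} [Group K] (φ : G →* K) (t : H73Exponents) :
    φ (normalForm y t) = normalForm (fun j => φ (y j)) t := by
  simp only [normalForm, cosetForm, kernelForm, IsCyclicFamily.twist, map_mul, map_pow, map_inv]

end NormalForm

theorem pow_val_add_of_mul_self {G : Type*} [Monoid G] {x : G} (hx : x * x = 1) (a b : ZMod 2) :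
    x ^ (a + b).val = x ^ a.val * x ^ b.val := by
  rw [ZMod.val_add, ← pow_add, ← pow_mod_orderOf x (a.val + b.val)]
  exact (pow_eq_pow_mod _ (by rw [pow_two, hx])).symm.trans (pow_mod_orderOf _ _).symm

namespace H73Exponents

/-- Left multiplication by `y 0` on exponents of normal forms. -/
def mulZero : Equiv.Perm H73Exponents where
  toFun := fun ((i, j, k), v) => ((i + 1, j, k), (i, 0, 0, i * (j + k)) + v)
  invFun := fun ((i, j, k), v) => ((i + 1, j, k), (i + 1, 0, 0, (i + 1) * (j + k)) + v)
  left_inv := by unfold Function.LeftInverse; decide +kernel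
  right_inv := by unfold Function.RightInverse Function.LeftInverse; decide +kernel

/-- Left multiplication by `y 1` on exponents of normal forms. -/
def mulOne : Equiv.Perm H73Exponents where
  toFun := fun ((i, j, k), v) => ((i, j + 1, k), (0, j, i, j * k) + v)
  invFun := fun ((i, j, k), v) => ((i, j + 1, k), (0, j + 1, i, (j + 1) * k) + v)
  left_inv := by unfold Function.LeftInverse; decide +kernel
  right_inv := by unfold Function.RightInverse Function.LeftInverse; decide +kernel

/-- Left multiplication by `y 2` on exponents of normal forms. -/
def mulTwo : Equiv.Perm H73Exponents where
  toFun := fun ((i, j, k), v) => ((i, j, k + 1), (j, i + j, i + k, i * k) + v)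
  invFun := fun ((i, j, k), v) => ((i, j, k + 1), (j, i + j, i + (k + 1), i * (k + 1)) + v)
  left_inv := by unfold Function.LeftInverse; decide +kernel
  right_inv := by unfold Function.RightInverse Function.LeftInverse; decide +kernel

/-- Left multiplication by the generators on exponents of normal forms. -/
def mulGen : ZMod 7 → Equiv.Perm H73Exponents :=
  ![mulZero, mulOne, mulTwo, mulTwo⁻¹ * mulZero, mulOne * mulTwo * mulZero, mulZero * mulOne,
    mulOne * mulTwo]

theorem isCyclicFamily_mulGen : IsCyclicFamily mulGen where
  mul_succ j := by
    have h : ∀ j : ZMod 7, ∀ t, (mulGen j * mulGen (j + 1)) t = mulGen (j + 5) t := by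
      decide +kernel
    exact Equiv.ext (h j)
  prod_eq_one := by
    have h : ∀ t, (mulGen 0 * mulGen 1 * mulGen 2 * mulGen 3 * mulGen 4 * mulGen 5 * mulGen 6) t
        = t := by decide +kernel
    exact Equiv.ext h

theorem normalForm_mulGen_apply_zero (t : H73Exponents) : normalForm mulGen t 0 = t := by
  revert t
  decide +kernel

end H73Exponents

namespace IsCyclicFamily

variable {G : Type*} [Group G] {y : ZMod 7 → G}

theorem kernelForm_add (h : IsCyclicFamily y) (v v' : ZMod 2 × ZMod 2 × ZMod 2 × ZMod 2) :
    kernelForm y (v + v') = kernelForm y v * kernelForm y v' := by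
  have h01 := h.sq_zero_commute_sq_one
  have h02 := h.sq_zero_commute_sq_two
  have h12 := h.sq_one_commute_sq_two
  have h0z := h.sq_zero_commute_twist
  have h1z := h.sq_one_commute_twist
  have h2z := h.sq_two_commute_twist
  simp only [kernelForm, Prod.fst_add, Prod.snd_add,
    pow_val_add_of_mul_self h.sq_zero_mul_sq_zero, pow_val_add_of_mul_self h.sq_one_mul_sq_one,
    pow_val_add_of_mul_self h.sq_two_mul_sq_two, pow_val_add_of_mul_self h.twist_mul_twist]
  rw [(h01.pow_pow _ _).mul_mul_mul_comm,
    ((h02.pow_pow _ _).mul_left (h12.pow_pow _ _)).mul_mul_mul_comm,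
    (((h0z.pow_pow _ _).mul_left (h1z.pow_pow _ _)).mul_left
      (h2z.pow_pow _ _)).mul_mul_mul_comm]

theorem one_mul_zero (h : IsCyclicFamily y) : y 1 * y 0 = y 0 * y 1 * (y 2 * y 2) := by
  have h01 : y 0 * y 1 = y 1 * y 0 * (y 2 * y 2) := (h.shift 1).mul_comm_succ
  rw [h01, mul_assoc, h.sq_two_mul_sq_two, mul_one]

theorem two_mul_one (h : IsCyclicFamily y) :
    y 2 * y 1 = y 1 * y 2 * (y 0 * y 0 * (y 1 * y 1)) := by
  rw [h.sq_zero_mul_sq_one]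
  exact (h.shift 1).one_mul_zero

theorem two_mul_zero (h : IsCyclicFamily y) :
    y 2 * y 0 = y 0 * y 2 * (y 1 * y 1 * (y 2 * y 2)) := by
  rw [h.sq_one_mul_sq_two, h.mul_comm_add_two]

theorem zero_mul_cosetForm (h : IsCyclicFamily y) (i j k : ZMod 2) :
    y 0 * cosetForm y (i, j, k) =
      cosetForm y (i + 1, j, k) * kernelForm y (i, 0, 0, i * (j + k)) := by
  have hcases : ∀ a : ZMod 2, a = 0 ∨ a = 1 := by decide
  have h11 : (1 + 1 : ZMod 2) = 0 := rfl
  rcases hcases i with rfl | rfl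
  · simp [cosetForm, kernelForm, ZMod.val_one, mul_assoc]
  · rcases hcases j with rfl | rfl <;> rcases hcases k with rfl | rfl <;>
      simp only [cosetForm, kernelForm, ZMod.val_one, ZMod.val_zero, h11, pow_zero, pow_one,
        one_mul, mul_one, mul_zero, zero_add, add_zero]
    · simpa only [mul_assoc] using h.sq_zero_mul_two
    · simpa only [mul_assoc] using h.sq_zero_mul_one
    · calc y 0 * (y 0 * y 1 * y 2) = y 0 * y 0 * y 1 * y 2 := by simp only [mul_assoc]
        _ = y 1 * (y 0 * y 0 * y 2) * twist y := by
          rw [h.sq_zero_mul_one, mul_assoc _ (twist y), h.twist_commute_two.eq]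
          simp only [mul_assoc]
        _ = y 1 * y 2 * (y 0 * y 0) * (twist y * twist y) := by
          rw [h.sq_zero_mul_two]; simp only [mul_assoc]
        _ = y 1 * y 2 * (y 0 * y 0) := by rw [h.twist_mul_twist, mul_one]

theorem one_mul_cosetForm (h : IsCyclicFamily y) (i j k : ZMod 2) :
    y 1 * cosetForm y (i, j, k) = cosetForm y (i, j + 1, k) * kernelForm y (0, j, i, j * k) := by
  have hcases : ∀ a : ZMod 2, a = 0 ∨ a = 1 := by decide
  have h11 : (1 + 1 : ZMod 2) = 0 := rfl
  have h101 : y 1 * y 0 * y 1 = y 0 * (y 1 * y 1) * (y 2 * y 2) := by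
    rw [h.one_mul_zero, mul_assoc, h.sq_two_commute_one.eq]
    simp only [mul_assoc]
  rcases hcases i with rfl | rfl <;> rcases hcases j with rfl | rfl <;>
    rcases hcases k with rfl | rfl <;>
    simp only [cosetForm, kernelForm, ZMod.val_one, ZMod.val_zero, h11, pow_zero, pow_one,
      one_mul, mul_one, mul_zero, zero_add]
  · simpa only [mul_assoc] using h.sq_one_mul_two
  · exact h.one_mul_zero
  · rw [← mul_assoc, h.one_mul_zero]
    simp only [mul_assoc]
  · simpa only [mul_assoc] using h101
  · calc y 1 * (y 0 * y 1 * y 2) = y 1 * y 0 * y 1 * y 2 := by simp only [mul_assoc]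
      _ = y 0 * (y 1 * y 1 * y 2) * (y 2 * y 2) := by rw [h101]; simp only [mul_assoc]
      _ = y 0 * y 2 * (y 1 * y 1) * (twist y * (y 2 * y 2)) := by
        rw [h.sq_one_mul_two]; simp only [mul_assoc]
      _ = _ := by rw [← h.sq_two_commute_twist.eq]; simp only [mul_assoc]

theorem two_mul_cosetForm (h : IsCyclicFamily y) (i j k : ZMod 2) :
    y 2 * cosetForm y (i, j, k) =
      cosetForm y (i, j, k + 1) * kernelForm y (j, i + j, i + k, i * k) := by
  have hcases : ∀ a : ZMod 2, a = 0 ∨ a = 1 := by decide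
  have h11 : (1 + 1 : ZMod 2) = 0 := rfl
  have h22 : Commute (y 2 * y 2) (y 2) := (Commute.refl (y 2)).mul_left (Commute.refl (y 2))
  have h32 : Commute (y 0 * y 0 * (y 1 * y 1)) (y 2) := by
    rw [h.sq_zero_mul_sq_one]
    exact (h.shift 4).commute_sq_pred
  have h11' : Commute (y 1 * y 1) (y 1) := (Commute.refl (y 1)).mul_left (Commute.refl (y 1))
  have h201 : y 2 * y 0 * y 1 = y 0 * y 1 * y 2 * (y 0 * y 0 * (y 2 * y 2)) := by
    calc y 2 * y 0 * y 1 = y 0 * (y 2 * y 1) * (y 1 * y 1 * (y 2 * y 2)) := by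
          rw [h.two_mul_zero, mul_assoc, (h11'.mul_left h.sq_two_commute_one).eq]
          simp only [mul_assoc]
      _ = y 0 * y 1 * y 2 * (y 0 * y 0) * (y 1 * y 1 * (y 1 * y 1)) * (y 2 * y 2) := by
          rw [h.two_mul_one]; simp only [mul_assoc]
      _ = _ := by rw [h.sq_one_mul_sq_one]; simp only [mul_assoc, one_mul]
  rcases hcases i with rfl | rfl <;> rcases hcases j with rfl | rfl <;>
    rcases hcases k with rfl | rfl <;>
    simp only [cosetForm, kernelForm, ZMod.val_one, ZMod.val_zero, h11, pow_zero, pow_one,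
      one_mul, mul_one, mul_zero, zero_add, add_zero]
  · exact h.two_mul_one
  · calc y 2 * (y 1 * y 2) = y 1 * y 2 * (y 0 * y 0 * (y 1 * y 1) * y 2) := by
          rw [← mul_assoc, h.two_mul_one, mul_assoc]
      _ = y 1 * (y 2 * y 2 * (y 0 * y 0 * (y 1 * y 1))) := by
          rw [h32.eq]; simp only [mul_assoc]
      _ = _ := by rw [(h32.mul_right h32).eq]
  · exact h.two_mul_zero
  · calc y 2 * (y 0 * y 2) = y 0 * y 2 * (y 1 * y 1) * (y 2 * y 2 * y 2) := by
          rw [← mul_assoc, h.two_mul_zero]; simp only [mul_assoc]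
      _ = y 0 * y 2 * (y 1 * y 1 * y 2) * (y 2 * y 2) := by rw [h22.eq]; simp only [mul_assoc]
      _ = y 0 * (y 2 * y 2 * (y 1 * y 1 * twist y)) * (y 2 * y 2) := by
          rw [h.sq_one_mul_two]; simp only [mul_assoc]
      _ = y 0 * (y 1 * y 1 * twist y) * (y 2 * y 2 * (y 2 * y 2)) := by
          rw [(h.sq_one_commute_sq_two.symm.mul_right h.sq_two_commute_twist).eq]
          simp only [mul_assoc]
      _ = _ := by rw [h.sq_two_mul_sq_two, mul_one]
  · rw [← mul_assoc, h201]
  · calc y 2 * (y 0 * y 1 * y 2) = y 0 * y 1 * y 2 * (y 0 * y 0) * (y 2 * y 2 * y 2) := by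
          rw [← mul_assoc, ← mul_assoc, h201]; simp only [mul_assoc]
      _ = y 0 * y 1 * y 2 * (y 0 * y 0 * y 2) * (y 2 * y 2) := by
          rw [h22.eq]; simp only [mul_assoc]
      _ = y 0 * y 1 * (y 2 * y 2 * (y 0 * y 0 * twist y)) * (y 2 * y 2) := by
          rw [h.sq_zero_mul_two]; simp only [mul_assoc]
      _ = y 0 * y 1 * (y 0 * y 0 * twist y) * (y 2 * y 2 * (y 2 * y 2)) := by
          rw [(h.sq_zero_commute_sq_two.symm.mul_right h.sq_two_commute_twist).eq]
          simp only [mul_assoc]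
      _ = _ := by rw [h.sq_two_mul_sq_two, mul_one]

theorem normalForm_mulGen (h : IsCyclicFamily y) (j : ZMod 7) (t : H73Exponents) :
    normalForm y (H73Exponents.mulGen j t) = y j * normalForm y t := by
  have h0 (t) : normalForm y (H73Exponents.mulZero t) = y 0 * normalForm y t := by
    obtain ⟨⟨i, j, k⟩, v⟩ := t
    simp only [normalForm, ← mul_assoc, h.zero_mul_cosetForm]
    simp only [H73Exponents.mulZero, Equiv.coe_fn_mk, h.kernelForm_add, mul_assoc]
  have h1 (t) : normalForm y (H73Exponents.mulOne t) = y 1 * normalForm y t := by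
    obtain ⟨⟨i, j, k⟩, v⟩ := t
    simp only [normalForm, ← mul_assoc, h.one_mul_cosetForm]
    simp only [H73Exponents.mulOne, Equiv.coe_fn_mk, h.kernelForm_add, mul_assoc]
  have h2 (t) : normalForm y (H73Exponents.mulTwo t) = y 2 * normalForm y t := by
    obtain ⟨⟨i, j, k⟩, v⟩ := t
    simp only [normalForm, ← mul_assoc, h.two_mul_cosetForm]
    simp only [H73Exponents.mulTwo, Equiv.coe_fn_mk, h.kernelForm_add, mul_assoc]
  have e0 : y 2 * y 3 = y 0 := h.mul_succ 2
  have e4 : y 6 * y 0 = y 4 := h.mul_succ 6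
  have e5 : y 0 * y 1 = y 5 := h.mul_succ 0
  have e6 : y 1 * y 2 = y 6 := h.mul_succ 1
  fin_cases j
  · exact h0 t
  · exact h1 t
  · exact h2 t
  · change normalForm y (H73Exponents.mulTwo⁻¹ (H73Exponents.mulZero t)) = y 3 * normalForm y t
    refine mul_left_cancel (a := y 2) ?_
    rw [← h2, ← Equiv.Perm.mul_apply, mul_inv_cancel, Equiv.Perm.one_apply, h0, ← mul_assoc, e0]
  · change normalForm y (H73Exponents.mulOne (H73Exponents.mulTwo (H73Exponents.mulZero t))) =
      y 4 * normalForm y t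
    rw [h1, h2, h0, ← e4, ← e6]
    simp only [mul_assoc]
  · change normalForm y (H73Exponents.mulZero (H73Exponents.mulOne t)) = y 5 * normalForm y t
    rw [h0, h1, ← e5, mul_assoc]
  · change normalForm y (H73Exponents.mulOne (H73Exponents.mulTwo t)) = y 6 * normalForm y t
    rw [h1, h2, ← e6, mul_assoc]

end IsCyclicFamily

/-- The generators `x (3 * j)` in the quotient of `H(7,3)` by the normal closure of `w`. -/
def H73QuotientGen (j : ZMod 7) : PresentedGroup H73Rels ⧸ Subgroup.normalClosure {H73w} :=
  QuotientGroup.mk' _ (PresentedGroup.of (3 * j))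

theorem isCyclicFamily_H73QuotientGen : IsCyclicFamily H73QuotientGen where
  mul_succ j := by
    have h : (PresentedGroup.of (3 * j) * PresentedGroup.of (3 * j + 3) *
        (PresentedGroup.of (3 * j + 1))⁻¹ : PresentedGroup H73Rels) = 1 :=
      PresentedGroup.one_of_mem ⟨3 * j, rfl⟩
    have h1 : 3 * (j + 1) = 3 * j + 3 := by ring
    have h5 : 3 * (j + 5) = 3 * j + 1 := by rw [mul_add]; rfl
    rw [H73QuotientGen, H73QuotientGen, H73QuotientGen, ← map_mul, h1, h5,
      mul_inv_eq_one.mp h]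
  prod_eq_one :=
    (QuotientGroup.eq_one_iff _).mpr (Subgroup.subset_normalClosure (Set.mem_singleton H73w))

theorem H73QuotientGen_five_mul (i : ZMod 7) :
    H73QuotientGen (5 * i) = QuotientGroup.mk' _ (PresentedGroup.of i) := by
  have h : (3 * 5 : ZMod 7) = 1 := rfl
  rw [H73QuotientGen, ← mul_assoc, h, one_mul]

theorem closure_range_H73QuotientGen : Subgroup.closure (Set.range H73QuotientGen) = ⊤ := by
  have h : Set.range H73QuotientGen =
      QuotientGroup.mk' (Subgroup.normalClosure {H73w}) '' Set.range PresentedGroup.of := by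
    rw [← Set.range_comp]
    ext g
    constructor
    · rintro ⟨j, rfl⟩
      exact ⟨3 * j, rfl⟩
    · rintro ⟨i, rfl⟩
      exact ⟨5 * i, H73QuotientGen_five_mul i⟩
  rw [h, ← MonoidHom.map_closure, PresentedGroup.closure_range_of, ← MonoidHom.range_eq_map,
    MonoidHom.range_eq_top]
  exact QuotientGroup.mk'_surjective _

namespace IsCyclicFamily

variable {K : Type*} [Group K] {y : ZMod 7 → K}

theorem exists_hom (h : IsCyclicFamily y) :
    ∃ φ : (PresentedGroup H73Rels ⧸ Subgroup.normalClosure {H73w}) →* K,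
      ∀ j, φ (H73QuotientGen j) = y j := by
  have hrel : ∀ r ∈ H73Rels, FreeGroup.lift (fun i => y (5 * i)) r = 1 := by
    rintro _ ⟨i, rfl⟩
    have h3 : 5 * (i + 3) = 5 * i + 1 := by rw [mul_add]; rfl
    have h1 : 5 * (i + 1) = 5 * i + 5 := by ring
    simp only [map_mul, map_inv, FreeGroup.lift_apply_of, h3, h1, h.mul_succ, mul_inv_cancel]
  have hw : H73w ∈ (PresentedGroup.toGroup hrel).ker := by
    simp only [MonoidHom.mem_ker, H73w, map_mul, PresentedGroup.toGroup.of]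
    exact h.prod_eq_one
  refine ⟨QuotientGroup.lift _ (PresentedGroup.toGroup hrel)
    (Subgroup.normalClosure_le_normal (Set.singleton_subset_iff.mpr hw)), fun j => ?_⟩
  have h15 : (5 * 3 : ZMod 7) = 1 := rfl
  change PresentedGroup.toGroup hrel (PresentedGroup.of (3 * j)) = y j
  rw [PresentedGroup.toGroup.of, ← mul_assoc, h15, one_mul]

end IsCyclicFamily

/-- The quotient of `H(7,3)` by the normal closure of `w = x₀ x₃ x₆ x₂ x₅ x₁ x₄`
is finite of order `128`. -/
theorem stmt_13 :
    Nat.card (PresentedGroup H73Rels ⧸ Subgroup.normalClosure {H73w}) = 128 := by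
  have h := isCyclicFamily_H73QuotientGen
  obtain ⟨φ, hφ⟩ := H73Exponents.isCyclicFamily_mulGen.exists_hom
  have hequiv : ∀ g t, normalForm H73QuotientGen (φ g t) = g * normalForm H73QuotientGen t := by
    intro g
    have hg : g ∈ Subgroup.closure (Set.range H73QuotientGen) := by
      simp [closure_range_H73QuotientGen]
    induction hg using Subgroup.closure_induction with
    | mem g hg =>
      obtain ⟨j, rfl⟩ := hg
      intro t
      rw [hφ, h.normalForm_mulGen]
    | one => simp
    | mul a b _ _ ha hb => intro t; rw [map_mul, Equiv.Perm.mul_apply, ha, hb, mul_assoc]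
    | inv a _ ha =>
      intro t
      rw [eq_inv_mul_iff_mul_eq, ← ha, map_inv, ← Equiv.Perm.mul_apply,
        mul_inv_cancel, Equiv.Perm.one_apply]
  let e : (PresentedGroup H73Rels ⧸ Subgroup.normalClosure {H73w}) ≃ H73Exponents :=
    { toFun := fun g => φ g 0
      invFun := normalForm H73QuotientGen
      left_inv := fun g => by rw [hequiv, normalForm_zero, mul_one]
      right_inv := fun t => by
        change φ (normalForm H73QuotientGen t) 0 = t
        rw [map_normalForm, funext hφ, H73Exponents.normalForm_mulGen_apply_zero] }
  rw [Nat.card_congr e, Nat.card_eq_fintype_card]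
  rfl
end

section
/- Let G be a group and let g, h ∈ G be elements with g of order exactly 2, h of order exactly 3, and g h = h g. Let l, k be nonzero integers and let Q be the quotient of the free product G ∗ F(x) (F(x) the free group on one generator x) by the normal closure of the element x^l · g · x^k · h. Then the natural homomorphism G → Q is bijective if and only if |l + k| = 1 and (l ≡ 0 mod 6 or k ≡ 0 mod 6). -/
open Monoid Monoid.Coprod

theorem pow_six_of_triangle_relations {K : Type*} [Group K] {t u : K} (ht : t ^ 6 = 1)
    (hu : u ^ 2 = 1) (hut : (u * t) ^ 3 = 1) : (t⁻¹ * t⁻¹ * u) ^ 6 = 1 := by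
  have hconj : t⁻¹ * t⁻¹ * u = (t⁻¹ * u) * t * (t⁻¹ * u)⁻¹ := by
    have hui : u⁻¹ = u := by rw [inv_eq_iff_mul_eq_one, ← sq, hu]
    have hutu : t⁻¹ * u = u * t * (u * t) := by
      rw [← hui, ← mul_inv_rev, hui, inv_eq_iff_mul_eq_one, ← hut]
      simp only [pow_succ, pow_zero, one_mul, mul_assoc]
    rw [mul_inv_rev, hui, inv_inv]
    simpa only [mul_assoc] using congrArg (t⁻¹ * ·) hutu
  rw [hconj, conj_pow, ht, mul_one, mul_inv_cancel]

theorem pow_six_of_relations {K : Type*} [Group K] {g h x : K} (hg : g ^ 2 = 1) (hh : h ^ 3 = 1)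
    (hcomm : Commute g h) (h₂ : (h * x) ^ 2 = 1) (h₃ : (x * g) ^ 3 = 1) : x ^ 6 = 1 := by
  have ht2 : (g * h⁻¹) ^ 2 = h := by
    rw [hcomm.inv_right.mul_pow, hg, one_mul, inv_pow, inv_eq_iff_mul_eq_one, ← pow_succ, hh]
  have ht6 : (g * h⁻¹) ^ 6 = 1 := by rw [pow_mul _ 2 3, ht2, hh]
  have hut : (h * x * (g * h⁻¹)) ^ 3 = 1 := by
    have : h * x * (g * h⁻¹) = h * (x * g) * h⁻¹ := by group
    rw [this, conj_pow, h₃, mul_one, mul_inv_cancel]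
  have hx : x = (g * h⁻¹)⁻¹ * (g * h⁻¹)⁻¹ * (h * x) := by
    rw [← mul_inv_rev, ← sq, ht2, inv_mul_cancel_left]
  rw [hx]
  exact pow_six_of_triangle_relations ht6 h₂ hut

theorem mul_eq_one_of_relator {K : Type*} [Group K] {g h x : K} (hg : g ^ 2 = 1) (hh : h ^ 3 = 1)
    (hcomm : Commute g h) {l k : ℤ} (hlk : l + k = 1) (hdvd : (6 : ℤ) ∣ l ∨ (6 : ℤ) ∣ k)
    (hr : x ^ l * g * x ^ k * h = 1) : x * (g * h) = 1 := by
  obtain rfl : l = 1 - k := by omega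
  have h₂ : h * x = x ^ (-k) * g⁻¹ * (x ^ (-k))⁻¹ := by
    have : h = (x ^ (1 - k) * g * x ^ k)⁻¹ := eq_inv_of_mul_eq_one_right hr
    rw [this]; group
  have h₃ : x * g = (x ^ k) * h⁻¹ * (x ^ k)⁻¹ := by
    have : h⁻¹ = x ^ (1 - k) * g * x ^ k := (eq_inv_of_mul_eq_one_left hr).symm
    rw [this]; group
  have hx : x ^ 6 = 1 := by
    refine pow_six_of_relations hg hh hcomm ?_ ?_
    · rw [h₂, conj_pow, inv_pow, hg]; simp
    · rw [h₃, conj_pow, inv_pow, hh]; simp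
  have hz (m : ℤ) : x ^ (6 * m) = 1 := by
    rw [zpow_mul]; norm_cast; rw [hx, one_zpow]
  rcases hdvd with ⟨m, hm⟩ | ⟨m, hm⟩
  · have hk : k = 1 - 6 * m := by omega
    rw [hm, hz, hk, zpow_sub, hz, zpow_one, inv_one, mul_one, one_mul] at hr
    rw [hcomm.eq, ← mul_assoc]
    exact mul_eq_one_comm.1 (by rwa [← mul_assoc])
  · rw [hm, zpow_sub, hz, zpow_one, inv_one, mul_one, mul_one] at hr
    rwa [← mul_assoc]

/-- The map `z ↦ a * z + b` as a permutation of a ring, for a unit `a`. -/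
def affinePerm {F : Type*} [CommRing F] (a : Fˣ) (b : F) : Equiv.Perm F where
  toFun z := a * z + b
  invFun z := (a⁻¹ : Fˣ) * (z - b)
  left_inv z := by simp
  right_inv z := by simp

theorem zpow_relator_of_emod {K : Type*} [Group K] {g h x : K} {r s : ℕ} (hx : x ^ 6 = 1)
    (hr : x ^ s * g * x ^ r * h = 1) {l k : ℤ} (hk : k % 6 = r % 6) (hl : l % 6 = s % 6) :
    x ^ l * g * x ^ k * h = 1 := by
  have key (n : ℤ) (m : ℕ) (hnm : n % 6 = m % 6) : x ^ n = x ^ m := by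
    rw [← zpow_natCast]
    refine zpow_eq_zpow_iff_modEq.2 (Int.ModEq.of_dvd ?_ hnm)
    exact_mod_cast orderOf_dvd_of_pow_eq_one hx
  rw [key l s hl, key k r hk, hr]

open Equiv in
theorem exists_noncommuting_solution {l k : ℤ} (hlk : l + k = 1) (hl : ¬ (6 : ℤ) ∣ l)
    (hk : ¬ (6 : ℤ) ∣ k) : ∃ (H : Type) (_ : Group H) (g h x : H), orderOf g = 2 ∧ orderOf h = 3 ∧
      Commute g h ∧ x ^ l * g * x ^ k * h = 1 ∧ ¬ Commute x g := by
  have hcases : k % 6 = 2 ∧ l % 6 = 5 ∨ k % 6 = 3 ∧ l % 6 = 4 ∨ k % 6 = 4 ∧ l % 6 = 3 ∨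
    k % 6 = 5 ∧ l % 6 = 2 := by omega
  rcases hcases with h | h | h | h
  · refine ⟨Perm (ZMod 7), inferInstance, affinePerm (-1) 0,
      affinePerm ⟨4, 2, by decide, by decide⟩ 0, affinePerm ⟨5, 3, by decide, by decide⟩ 2,
      orderOf_eq_prime (by decide) (by decide), orderOf_eq_prime (by decide) (by decide),
      by unfold Commute SemiconjBy; decide,
      zpow_relator_of_emod (r := 2) (s := 5) (by decide) (by decide) h.1 h.2,
      by unfold Commute SemiconjBy; decide⟩
  · refine ⟨Perm (ZMod 13), inferInstance, affinePerm (-1) 0,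
      affinePerm ⟨3, 9, by decide, by decide⟩ 0, affinePerm ⟨4, 10, by decide, by decide⟩ 9,
      orderOf_eq_prime (by decide) (by decide), orderOf_eq_prime (by decide) (by decide),
      by unfold Commute SemiconjBy; decide,
      zpow_relator_of_emod (r := 3) (s := 4) (by decide) (by decide) h.1 h.2,
      by unfold Commute SemiconjBy; decide⟩
  · refine ⟨Perm (ZMod 13), inferInstance, affinePerm (-1) 0,
      affinePerm ⟨9, 3, by decide, by decide⟩ 0, affinePerm ⟨10, 4, by decide, by decide⟩ 3,
      orderOf_eq_prime (by decide) (by decide), orderOf_eq_prime (by decide) (by decide),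
      by unfold Commute SemiconjBy; decide,
      zpow_relator_of_emod (r := 4) (s := 3) (by decide) (by decide) h.1 h.2,
      by unfold Commute SemiconjBy; decide⟩
  · refine ⟨Perm (ZMod 7), inferInstance, affinePerm (-1) 0,
      affinePerm ⟨2, 4, by decide, by decide⟩ 0, affinePerm ⟨3, 5, by decide, by decide⟩ 4,
      orderOf_eq_prime (by decide) (by decide), orderOf_eq_prime (by decide) (by decide),
      by unfold Commute SemiconjBy; decide,
      zpow_relator_of_emod (r := 5) (s := 2) (by decide) (by decide) h.1 h.2,
      by unfold Commute SemiconjBy; decide⟩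

theorem exists_injective_zmod_hom {G : Type*} [Group G] {a : G} {n : ℕ} (ha : orderOf a = n) :
    ∃ f : Multiplicative (ZMod n) →* G, Function.Injective f ∧
      ∀ m : ℤ, f (Multiplicative.ofAdd (m : ZMod n)) = a ^ m := by
  let φ : {f : ℤ →+ Additive G // f n = 0} :=
    ⟨zmultiplesHom (Additive G) (Additive.ofMul a), by
      simp [← ofMul_pow, ← ha, pow_orderOf_eq_one]⟩
  have hφ (m : ℤ) : (ZMod.lift n φ (m : ZMod n)).toMul = a ^ m := by
    rw [ZMod.lift_coe]; simp [φ]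
  refine ⟨AddMonoidHom.toMultiplicativeLeft (ZMod.lift n φ), ?_, hφ⟩
  have hinj : Function.Injective (ZMod.lift n φ) := by
    refine (ZMod.lift_injective n).2 fun m hm => ?_
    rw [ZMod.intCast_zmod_eq_zero_iff_dvd, ← ha]
    exact orderOf_dvd_iff_zpow_eq_one.2 hm
  exact hinj

universe u

/-- Two groups with elements of the same order embed in a common group in which these elements
coincide and the images meet only in the cyclic group they generate. -/
theorem exists_amalgam {G H : Type u} [Group G] [Group H] {a : G} {b : H}
    (hab : orderOf a = orderOf b) :
    ∃ (P : Type u) (_ : Group P) (i : G →* P) (j : H →* P), i a = j b ∧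
      ∀ x y, i x = j y → y ∈ Subgroup.zpowers b := by
  obtain ⟨φ, hφ, hφa⟩ := exists_injective_zmod_hom hab
  obtain ⟨ψ, hψ, hψb⟩ := exists_injective_zmod_hom (rfl : orderOf b = _)
  let F : Bool → Type u := fun c => Bool.rec (motive := fun _ => Type u) G H c
  let _ : ∀ c, Group (F c) :=
    fun c => Bool.rec (motive := fun c => Group (F c)) ‹Group G› ‹Group H› c
  let θ : ∀ c, Multiplicative (ZMod (orderOf b)) →* F c := fun c =>
    Bool.rec (motive := fun c => Multiplicative (ZMod (orderOf b)) →* F c) φ ψ c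
  have hθ : ∀ c, Function.Injective (θ c) := by
    rintro (_ | _)
    exacts [hφ, hψ]
  let i : G →* PushoutI θ := PushoutI.of (φ := θ) false
  let j : H →* PushoutI θ := PushoutI.of (φ := θ) true
  have hi (z) : i (φ z) = PushoutI.base θ z := PushoutI.of_apply_eq_base θ false z
  have hj (z) : j (ψ z) = PushoutI.base θ z := PushoutI.of_apply_eq_base θ true z
  refine ⟨PushoutI θ, inferInstance, i, j, ?_, fun x y hxy => ?_⟩
  · have ha := hφa 1
    have hb := hψb 1
    rw [zpow_one] at ha hb
    exact (congrArg i ha).symm.trans (((hi _).trans (hj _).symm).trans (congrArg j hb))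
  · have hy : j y ∈ (PushoutI.base θ).range := by
      rw [← PushoutI.inf_of_range_eq_base_range hθ Bool.false_ne_true]
      exact ⟨⟨x, hxy⟩, ⟨y, rfl⟩⟩
    obtain ⟨z, hz⟩ := hy
    rw [← hj] at hz
    obtain rfl : ψ z = y := PushoutI.of_injective hθ true hz
    obtain ⟨m, hm⟩ := ZMod.intCast_surjective (Multiplicative.toAdd z)
    exact ⟨m, by rw [← ofAdd_toAdd z, ← hm]; exact (hψb m).symm⟩

theorem exists_amalgam_of_commute {G H : Type u} [Group G] [Group H]
    {g h : G} {g' h' : H} (hg : orderOf g = 2) (hh : orderOf h = 3) (hc : Commute g h)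
    (hg' : orderOf g' = 2) (hh' : orderOf h' = 3) (hc' : Commute g' h') :
    ∃ (P : Type u) (_ : Group P) (i : G →* P) (j : H →* P), i g = j g' ∧ i h = j h' ∧
      ∀ x y, i x = j y → Commute y g' := by
  have ho {K : Type u} [Group K] {a b : K} (ha : orderOf a = 2) (hb : orderOf b = 3)
      (hab : Commute a b) : orderOf (a * b) = 6 ∧ (a * b) ^ 3 = a ∧ (a * b) ^ 4 = b := by
    have ha2 : a ^ 2 = 1 := ha ▸ pow_orderOf_eq_one a
    have hb3 : b ^ 3 = 1 := hb ▸ pow_orderOf_eq_one b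
    refine ⟨?_, ?_, ?_⟩
    · rw [hab.orderOf_mul_eq_mul_orderOf_of_coprime (by rw [ha, hb]; norm_num), ha, hb]
    · rw [hab.mul_pow, hb3, pow_succ, ha2, one_mul, mul_one]
    · rw [hab.mul_pow, pow_succ b, hb3, pow_mul a 2 2, ha2, one_pow, one_mul, one_mul]
  obtain ⟨o, h3, h4⟩ := ho hg hh hc
  obtain ⟨o', h3', h4'⟩ := ho hg' hh' hc'
  obtain ⟨P, _, i, j, hij, hP⟩ := exists_amalgam (o.trans o'.symm)
  refine ⟨P, inferInstance, i, j, ?_, ?_, fun x y hxy => ?_⟩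
  · rw [← h3, ← h3', map_pow, map_pow, hij]
  · rw [← h4, ← h4', map_pow, map_pow, hij]
  · obtain ⟨m, rfl⟩ := hP x y hxy
    exact Commute.zpow_left ((Commute.refl g').mul_left hc'.symm) m

theorem not_surjective_of_noncommuting_solution {G : Type u} {H : Type} [Group G] [Group H]
    {g h : G} {g' h' y : H} (hg : orderOf g = 2) (hh : orderOf h = 3) (hc : Commute g h)
    (hg' : orderOf g' = 2) (hh' : orderOf h' = 3) (hc' : Commute g' h') {l k : ℤ}
    (hr : y ^ l * g' * y ^ k * h' = 1) (hy : ¬ Commute y g') {Q : Type*} [Group Q]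
    (f : G →* Q) (x : Q)
    (huniv : ∀ (P : Type u) [Group P] (i : G →* P) (z : P), z ^ l * i g * z ^ k * i h = 1 →
      ∃ F : Q →* P, F.comp f = i ∧ F x = z) : ¬ Function.Surjective f := by
  intro hf
  let e : H ≃* ULift.{u} H := MulEquiv.ulift.symm
  obtain ⟨P, _, i, j, hig, hih, hP⟩ := exists_amalgam_of_commute (g' := e g') (h' := e h') hg hh hc
    (by rw [e.orderOf_eq, hg']) (by rw [e.orderOf_eq, hh']) (hc'.map e)
  obtain ⟨F, hF, hFx⟩ := huniv P i (j (e y)) (by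
    rw [hig, hih]
    simp only [← map_zpow, ← map_mul, hr, map_one])
  obtain ⟨w, hw⟩ := hf x
  have : i w = j (e y) := by rw [← hFx, ← hw, ← hF]; rfl
  exact hy (by simpa using (hP w _ this).map e.symm)

theorem abs_eq_one_and_dvd_of_surjective {G : Type u} [Group G] {g h : G} (hg : orderOf g = 2)
    (hh : orderOf h = 3) (hc : Commute g h) {l k : ℤ} {Q : Type*} [Group Q] (f : G →* Q) (x : Q)
    (huniv : ∀ (P : Type u) [Group P] (i : G →* P) (z : P), z ^ l * i g * z ^ k * i h = 1 →
      ∃ F : Q →* P, F.comp f = i ∧ F x = z) (hf : Function.Surjective f) :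
    |l + k| = 1 ∧ ((6 : ℤ) ∣ l ∨ (6 : ℤ) ∣ k) := by
  have habs : |l + k| = 1 := by
    obtain ⟨F, hF, hFx⟩ := huniv (ULift (Multiplicative (ZMod (l + k).natAbs))) 1
      ⟨Multiplicative.ofAdd 1⟩ (by
        rw [MonoidHom.one_apply, MonoidHom.one_apply, mul_one, mul_one, ← zpow_add]
        apply ULift.ext
        change Multiplicative.ofAdd (1 : ZMod (l + k).natAbs) ^ (l + k) = 1
        rw [← ofAdd_zsmul, zsmul_one, ofAdd_eq_one, ZMod.intCast_zmod_eq_zero_iff_dvd]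
        exact Int.natAbs_dvd_self)
    obtain ⟨w, rfl⟩ := hf x
    have h1 : F (f w) = 1 := DFunLike.congr_fun hF w
    rw [h1] at hFx
    have h10 : ((1 : ℕ) : ZMod (l + k).natAbs) = 0 := by
      simpa using (congrArg (fun a => a.down.toAdd) hFx).symm
    rw [ZMod.natCast_eq_zero_iff, Nat.dvd_one] at h10
    rw [Int.abs_eq_natAbs, h10, Nat.cast_one]
  refine ⟨habs, ?_⟩
  by_contra! hndvd
  rcases eq_or_eq_neg_of_abs_eq habs with hlk | hlk
  · obtain ⟨H, _, g', h', y, hg', hh', hc', hr, hy⟩ :=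
      exists_noncommuting_solution hlk hndvd.1 hndvd.2
    exact not_surjective_of_noncommuting_solution hg hh hc hg' hh' hc' hr hy f x huniv hf
  · obtain ⟨H, _, g', h', y, hg', hh', hc', hr, hy⟩ :=
      exists_noncommuting_solution (l := -l) (k := -k) (by omega) (by simpa using hndvd.1)
        (by simpa using hndvd.2)
    refine not_surjective_of_noncommuting_solution hg hh hc hg' hh' hc' (y := y⁻¹) ?_
      (by rwa [Commute.inv_left_iff]) f x huniv hf
    simpa using hr

theorem bijective_of_abs_eq_one_of_dvd {G : Type u} [Group G] {g h : G} (hg : g ^ 2 = 1)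
    (hh : h ^ 3 = 1) (hc : Commute g h) {l k : ℤ} {Q : Type*} [Group Q] (f : G →* Q) (x : Q)
    (huniv : ∀ (P : Type u) [Group P] (i : G →* P) (z : P), z ^ l * i g * z ^ k * i h = 1 →
      ∃ F : Q →* P, F.comp f = i ∧ F x = z) (hr : x ^ l * f g * x ^ k * f h = 1)
    (hgen : ∀ S : Subgroup Q, f.range ≤ S → x ∈ S → S = ⊤)
    (hlk : |l + k| = 1) (hdvd : (6 : ℤ) ∣ l ∨ (6 : ℤ) ∣ k) : Function.Bijective f := by
  have hg' : f g ^ 2 = 1 := by rw [← map_pow, hg, map_one]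
  have hh' : f h ^ 3 = 1 := by rw [← map_pow, hh, map_one]
  constructor
  · obtain ⟨z, hzc, hz⟩ : ∃ z : G, Commute z g ∧ z ^ (l + k) = (g * h)⁻¹ := by
      have hgh : Commute (g * h) g := (Commute.refl g).mul_left hc.symm
      rcases eq_or_eq_neg_of_abs_eq hlk with e | e
      · exact ⟨(g * h)⁻¹, hgh.inv_left, by rw [e, zpow_one]⟩
      · exact ⟨g * h, hgh, by rw [e, zpow_neg_one]⟩
    obtain ⟨F, hF, -⟩ := huniv G (MonoidHom.id G) z (by
      simp only [MonoidHom.id_apply]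
      rw [mul_assoc (z ^ l), ← (hzc.zpow_left k).eq, ← mul_assoc, ← zpow_add, hz, mul_assoc,
        inv_mul_cancel])
    exact Function.LeftInverse.injective (g := F) fun a => DFunLike.congr_fun hF a
  · refine MonoidHom.range_eq_top.1 (hgen _ le_rfl ?_)
    rcases eq_or_eq_neg_of_abs_eq hlk with e | e
    · have := mul_eq_one_of_relator hg' hh' (hc.map f) e hdvd hr
      rw [eq_inv_of_mul_eq_one_left this, ← map_mul, ← map_inv]
      exact ⟨_, rfl⟩
    · have := mul_eq_one_of_relator (x := x⁻¹) (l := -l) (k := -k) hg' hh' (hc.map f) (by omega)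
        (by simpa using hdvd) (by simpa using hr)
      rw [inv_mul_eq_one.1 this, ← map_mul]
      exact ⟨_, rfl⟩

/-- Case (J₆) of Theorem 4.1: for commuting `g, h ∈ G` with `|g| = 2`, `|h| = 3`,
and nonzero integers `l, k`, the natural map `G → ⟨G, x | xˡ g xᵏ h⟩` is an
isomorphism iff `|l + k| = 1` and (`6 ∣ l` or `6 ∣ k`). -/
theorem stmt_17 {G : Type*} [Group G] (g h : G) (hg : orderOf g = 2)
    (hh : orderOf h = 3) (hcomm : g * h = h * g)
    (l k : ℤ) (hl : l ≠ 0) (hk : k ≠ 0) :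
    Function.Bijective
      ((QuotientGroup.mk' (Subgroup.normalClosure
          ({(Coprod.inr (FreeGroup.of ()) : Coprod G (FreeGroup Unit)) ^ l * Coprod.inl g *
            (Coprod.inr (FreeGroup.of ()) : Coprod G (FreeGroup Unit)) ^ k * Coprod.inl h} :
            Set (Coprod G (FreeGroup Unit))))).comp
        (Coprod.inl : G →* Coprod G (FreeGroup Unit))) ↔
      (|l + k| = 1 ∧ ((6 : ℤ) ∣ l ∨ (6 : ℤ) ∣ k)) := by
  set r : Coprod G (FreeGroup Unit) := Coprod.inr (FreeGroup.of ()) ^ l * Coprod.inl g *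
    Coprod.inr (FreeGroup.of ()) ^ k * Coprod.inl h with hrdef
  set π := QuotientGroup.mk' (Subgroup.normalClosure {r})
  have hc : Commute g h := hcomm
  have hr : π (Coprod.inr (FreeGroup.of ())) ^ l * π.comp Coprod.inl g *
      π (Coprod.inr (FreeGroup.of ())) ^ k * π.comp Coprod.inl h = 1 := by
    have : π r = 1 := (QuotientGroup.eq_one_iff r).2 (Subgroup.subset_normalClosure rfl)
    simpa [hrdef] using this
  have huniv : ∀ (P : Type _) [Group P] (i : G →* P) (z : P), z ^ l * i g * z ^ k * i h = 1 →
      ∃ F : Coprod G (FreeGroup Unit) ⧸ Subgroup.normalClosure {r} →* P,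
        F.comp (π.comp Coprod.inl) = i ∧ F (π (Coprod.inr (FreeGroup.of ()))) = z := by
    intro P _ i z hz
    let L : Coprod G (FreeGroup Unit) →* P := Coprod.lift i (FreeGroup.lift fun _ => z)
    have hker : Subgroup.normalClosure {r} ≤ L.ker := by
      refine Subgroup.normalClosure_le_normal ?_
      rw [Set.singleton_subset_iff, SetLike.mem_coe, MonoidHom.mem_ker]
      simpa [hrdef, L] using hz
    refine ⟨QuotientGroup.lift _ L hker, MonoidHom.ext fun a => ?_, ?_⟩
    · change L (Coprod.inl a) = i a
      simp [L]
    · change L (Coprod.inr (FreeGroup.of ())) = z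
      simp [L]
  refine ⟨fun hb => abs_eq_one_and_dvd_of_surjective hg hh hc _ _ huniv hb.2, fun hb =>
    bijective_of_abs_eq_one_of_dvd (hg ▸ pow_orderOf_eq_one g) (hh ▸ pow_orderOf_eq_one h) hc _ _
      huniv hr (fun S hS hx => ?_) hb.1 hb.2⟩
  rw [eq_top_iff]
  intro q _
  obtain ⟨w, rfl⟩ := QuotientGroup.mk'_surjective _ q
  induction w using Coprod.induction_on with
  | inl a => exact hS ⟨a, rfl⟩
  | inr a =>
    induction a using FreeGroup.induction_on with
    | C1 => simp
    | of u => exact hx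
    | inv_of u _ => simpa only [map_inv] using S.inv_mem hx
    | mul a b ha hb => simpa only [map_mul] using S.mul_mem (ha trivial) (hb trivial)
  | mul a b ha hb => simpa only [map_mul] using S.mul_mem (ha trivial) (hb trivial)
end
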